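/- Let G with list assignment L and precolored path P be a minimal counterexample configuration for the precolored-path 5-choosability theorem. Then G contains no separating 4-cycle, i.e., for every 4-cycle K in G, no vertex of G lies in the open disc bounded by K. -/

import Mathlib

open Set

noncomputable section

/-- A drawing of a simple graph in the plane: vertices are mapped to distinct points,
each edge is realized by a simple arc joining the images of its endpoints, arcs do not
pass through vertex points, any two arcs realizing distinct edges meet in at most one
point, and no point of the plane that is not a vertex point lies on three or more arcs. -/
structure Drawing {V : Type} (G : SimpleGraph V) where
  pos : V → ℝ × ℝ
  pos_inj : Function.Injective pos
  arc : ∀ ⦃u v : V⦄, G.Adj u v → Path (pos u) (pos v)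
  arc_symm : ∀ ⦃u v : V⦄ (h : G.Adj u v), arc h.symm = (arc h).symm
  arc_inj : ∀ ⦃u v : V⦄ (h : G.Adj u v), Function.Injective ⇑(arc h)
  arc_vertex : ∀ ⦃u v : V⦄ (h : G.Adj u v) (t : unitInterval) (w : V),
    arc h t = pos w → t = 0 ∨ t = 1
  arc_meet_once : ∀ ⦃u v x y : V⦄ (h₁ : G.Adj u v) (h₂ : G.Adj x y),
    s(u, v) ≠ s(x, y) → (Set.range ⇑(arc h₁) ∩ Set.range ⇑(arc h₂)).Subsingleton
  arc_no_triple : ∀ ⦃u₁ v₁ u₂ v₂ u₃ v₃ : V⦄ (h₁ : G.Adj u₁ v₁) (h₂ : G.Adj u₂ v₂)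
    (h₃ : G.Adj u₃ v₃), s(u₁, v₁) ≠ s(u₂, v₂) → s(u₁, v₁) ≠ s(u₃, v₃) →
    s(u₂, v₂) ≠ s(u₃, v₃) →
    ∀ p ∈ Set.range ⇑(arc h₁) ∩ Set.range ⇑(arc h₂) ∩ Set.range ⇑(arc h₃),
      ∃ w : V, p = pos w

namespace Drawing

variable {V : Type} {G : SimpleGraph V} (D : Drawing G)

/-- The set of points used by the arc of an edge. -/
def arcSet ⦃u v : V⦄ (h : G.Adj u v) : Set (ℝ × ℝ) :=
  Set.range ⇑(D.arc h)

/-- The set of interior points of the arc of an edge. -/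
def arcInterior ⦃u v : V⦄ (h : G.Adj u v) : Set (ℝ × ℝ) :=
  ⇑(D.arc h) '' {t : unitInterval | t ≠ 0 ∧ t ≠ 1}

/-- All points of the plane used by the drawing. -/
def graphSet : Set (ℝ × ℝ) :=
  Set.range D.pos ∪ ⋃ (u : V) (v : V) (h : G.Adj u v), D.arcSet h

/-- A crossing of a drawing: a point interior to the arcs of two distinct edges. -/
def IsCrossing (p : ℝ × ℝ) : Prop :=
  ∃ (u v x y : V) (h₁ : G.Adj u v) (h₂ : G.Adj x y),
    s(u, v) ≠ s(x, y) ∧ p ∈ D.arcInterior h₁ ∧ p ∈ D.arcInterior h₂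

/-- A drawing is plane if it has no crossings. -/
def IsPlane : Prop := ∀ p : ℝ × ℝ, ¬ D.IsCrossing p

/-- The faces of a drawing are the connected components of the complement
of the drawing. -/
def IsFace (f : Set (ℝ × ℝ)) : Prop :=
  ∃ q : ℝ × ℝ, q ∉ D.graphSet ∧ f = connectedComponentIn D.graphSetᶜ q

/-- The outer (unbounded) face of a drawing. -/
def outerFace : Set (ℝ × ℝ) :=
  {p : ℝ × ℝ | p ∉ D.graphSet ∧
    ¬ Bornology.IsBounded (connectedComponentIn D.graphSetᶜ p)}

/-- A vertex lies on the outer face if its point is on the boundary of the outer face. -/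
def OnOuter (v : V) : Prop := D.pos v ∈ frontier D.outerFace

/-- The set of points of the plane used by the drawing of a walk. -/
def walkSet {a b : V} (W : G.Walk a b) : Set (ℝ × ℝ) :=
  D.pos '' {v : V | v ∈ W.support} ∪ ⋃ d ∈ W.darts, D.arcSet d.adj

/-- A closed walk bounds the outer face if the boundary of the outer face is exactly
the drawing of the walk. -/
def BoundsOuter {a : V} (W : G.Walk a a) : Prop :=
  frontier D.outerFace = D.walkSet W

end Drawing

/-- The open region enclosed by a set `S` (typically the drawing of a cycle):
all points outside `S` whose connected component in the complement of `S` is bounded. -/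
def enclosed (S : Set (ℝ × ℝ)) : Set (ℝ × ℝ) :=
  {p : ℝ × ℝ | p ∉ S ∧ Bornology.IsBounded (connectedComponentIn Sᶜ p)}

namespace Drawing

variable {V : Type} {G : SimpleGraph V} (D : Drawing G)

/-- The closed disc bounded by (the drawing of) a closed walk. -/
def closedDisc {a : V} (W : G.Walk a a) : Set (ℝ × ℝ) :=
  D.walkSet W ∪ enclosed (D.walkSet W)

/-- The endpoints of the (two) edges incident with a crossing point `p`. -/
def crossingEnds (p : ℝ × ℝ) : Set V :=
  {w : V | ∃ (z : V) (h : G.Adj w z), p ∈ D.arcInterior h}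

end Drawing

/-- A proper colouring of `G` from the lists `L`. -/
def IsListColoring {V : Type} (G : SimpleGraph V) (L : V → Finset ℕ) (c : V → ℕ) : Prop :=
  (∀ v, c v ∈ L v) ∧ ∀ ⦃u v : V⦄, G.Adj u v → c u ≠ c v

/-- `G` is colourable from the lists `L`. -/
def ListColorable {V : Type} (G : SimpleGraph V) (L : V → Finset ℕ) : Prop :=
  ∃ c : V → ℕ, IsListColoring G L c


/-- A counterexample configuration for the precolored-path 5-choosability theorem:
a plane graph `G` (on vertex set `Fin n`), a path `P` of length at most two contained in
the boundary of the outer face, and a list assignment `L` satisfying conditions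
(i)–(vi) of the theorem, such that `G` is not `L`-colorable. -/
structure Config where
  n : ℕ
  G : SimpleGraph (Fin n)
  D : Drawing G
  plane : D.IsPlane
  a : Fin n
  b : Fin n
  P : G.Walk a b
  P_path : P.IsPath
  P_len : P.length ≤ 2
  P_boundary : D.walkSet P ⊆ frontier D.outerFace
  L : Fin n → Finset ℕ
  size5 : ∀ v, ¬ D.OnOuter v → 5 ≤ (L v).card
  size3 : ∀ v, D.OnOuter v → v ∉ P.support → 3 ≤ (L v).card
  size1 : ∀ v ∈ P.support, (L v).card = 1
  no_adjacent_3 : ∀ u v, G.Adj u v → (L u).card = 3 → (L v).card ≠ 3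
  proper_on_P : ∀ u ∈ P.support, ∀ v ∈ P.support, G.Adj u v → L u ≠ L v
  common_neighbor : ∀ p₀ p₁ p₂ : Fin n, P.support = [p₀, p₁, p₂] →
    ∀ x, G.Adj x p₀ → G.Adj x p₁ → G.Adj x p₂ → L x ≠ L p₀ ∪ L p₁ ∪ L p₂
  not_colorable : ¬ ListColorable G L

/-- The number of vertices plus the number of edges of a configuration. -/
def Config.size (C : Config) : ℕ := C.n + C.G.edgeSet.ncard

/-- The length of the precolored path of a configuration. -/
def Config.plen (C : Config) : ℕ := C.P.length

/-- The total size of the lists of a configuration. -/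
def Config.lsize (C : Config) : ℕ := ∑ v : Fin C.n, (C.L v).card

/-- A minimal counterexample configuration: `|V(G)| + |E(G)|` is minimum, subject to
that the precolored path is as long as possible, and subject to that the total size of
the lists is minimum. -/
def Config.Minimal (C : Config) : Prop :=
  (∀ C' : Config, C.size ≤ C'.size) ∧
  (∀ C' : Config, C'.size = C.size → C'.plen ≤ C.plen) ∧
  (∀ C' : Config, C'.size = C.size → C'.plen = C.plen → C.lsize ≤ C'.lsize)



/-- Points outside `S` whose component in the complement of `S` is unbounded. -/
def extSet (S : Set (ℝ × ℝ)) : Set (ℝ × ℝ) :=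
  {p : ℝ × ℝ | p ∉ S ∧ ¬ Bornology.IsBounded (connectedComponentIn Sᶜ p)}

theorem extSet_of_preconn {S T : Set (ℝ × ℝ)} {p q : ℝ × ℝ} (hT : IsPreconnected T)
    (hTS : T ⊆ Sᶜ) (hp : p ∈ T) (hq : q ∈ T) (hpe : p ∈ extSet S) : q ∈ extSet S := by
  refine ⟨hTS hq, ?_⟩
  have : q ∈ connectedComponentIn Sᶜ p := hT.subset_connectedComponentIn hp hTS hq
  rw [← connectedComponentIn_eq this]
  exact hpe.2

theorem enclosed_of_preconn {S T : Set (ℝ × ℝ)} {p q : ℝ × ℝ} (hT : IsPreconnected T)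
    (hTS : T ⊆ Sᶜ) (hp : p ∈ T) (hq : q ∈ T) (hpe : p ∈ enclosed S) : q ∈ enclosed S := by
  refine ⟨hTS hq, ?_⟩
  have : q ∈ connectedComponentIn Sᶜ p := hT.subset_connectedComponentIn hp hTS hq
  rw [← connectedComponentIn_eq this]
  exact hpe.2

theorem not_enclosed_of_ext {S : Set (ℝ × ℝ)} {p : ℝ × ℝ} (h : p ∈ extSet S) :
    p ∉ enclosed S := fun h' => h.2 h'.2

theorem ext_or_enclosed {S : Set (ℝ × ℝ)} {p : ℝ × ℝ} (h : p ∉ S) (h' : p ∉ enclosed S) :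
    p ∈ extSet S := ⟨h, fun hb => h' ⟨h, hb⟩⟩

theorem component_subset_ext {S : Set (ℝ × ℝ)} {p : ℝ × ℝ} (h : p ∈ extSet S) :
    connectedComponentIn Sᶜ p ⊆ extSet S := fun _ hq =>
  extSet_of_preconn isPreconnected_connectedComponentIn (connectedComponentIn_subset _ _)
    (mem_connectedComponentIn h.1) hq h

theorem component_subset_enclosed {S : Set (ℝ × ℝ)} {p : ℝ × ℝ} (h : p ∈ enclosed S) :
    connectedComponentIn Sᶜ p ⊆ enclosed S := fun _ hq =>
  enclosed_of_preconn isPreconnected_connectedComponentIn (connectedComponentIn_subset _ _)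
    (mem_connectedComponentIn h.1) hq h

theorem isOpen_ext {S : Set (ℝ × ℝ)} (hS : IsClosed S) : IsOpen (extSet S) := by
  rw [isOpen_iff_mem_nhds]
  intro p hp
  exact Filter.mem_of_superset
    (connectedComponentIn_mem_nhds (hS.isOpen_compl.mem_nhds hp.1)) (component_subset_ext hp)

theorem isOpen_enclosed {S : Set (ℝ × ℝ)} (hS : IsClosed S) : IsOpen (enclosed S) := by
  rw [isOpen_iff_mem_nhds]
  intro p hp
  exact Filter.mem_of_superset
    (connectedComponentIn_mem_nhds (hS.isOpen_compl.mem_nhds hp.1)) (component_subset_enclosed hp)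

theorem ext_of_closure {S : Set (ℝ × ℝ)} (hS : IsClosed S) {p : ℝ × ℝ}
    (hp : p ∈ closure (extSet S)) (hpS : p ∉ S) : p ∈ extSet S := by
  by_contra h
  have h' : p ∈ enclosed S := by
    refine ⟨hpS, ?_⟩
    by_contra hb
    exact h ⟨hpS, hb⟩
  obtain ⟨q, hq1, hq2⟩ := mem_closure_iff.1 hp _ (isOpen_enclosed hS) h'
  exact not_enclosed_of_ext hq2 hq1

theorem frontier_ext_subset {S : Set (ℝ × ℝ)} (hS : IsClosed S) :
    frontier (extSet S) ⊆ S := by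
  intro p hp
  by_contra hpS
  have := ext_of_closure hS hp.1 hpS
  rw [(isOpen_ext hS).frontier_eq] at hp
  exact hp.2 this

theorem mem_frontier_ext {S : Set (ℝ × ℝ)} {p : ℝ × ℝ}
    (hp : p ∈ closure (extSet S)) (hpS : p ∈ S) : p ∈ frontier (extSet S) :=
  ⟨hp, fun h => (interior_subset h).1 hpS⟩

theorem ext_anti {S T : Set (ℝ × ℝ)} (h : S ⊆ T) : extSet T ⊆ extSet S := by
  intro p hp
  refine ⟨fun h' => hp.1 (h h'), fun hb => hp.2 (hb.subset ?_)⟩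
  exact connectedComponentIn_mono p (compl_subset_compl.2 h)

theorem ext_subset_ext {S T : Set (ℝ × ℝ)} (h : T ⊆ S ∪ enclosed S) : extSet S ⊆ extSet T := by
  have key : ∀ q ∈ extSet S, q ∉ T := by
    intro q hq hqT
    rcases h hqT with h1 | h1
    · exact hq.1 h1
    · exact not_enclosed_of_ext hq h1
  intro p hp
  refine ⟨key p hp, fun hb => hp.2 (hb.subset ?_)⟩
  exact isPreconnected_connectedComponentIn.subset_connectedComponentIn
    (mem_connectedComponentIn hp.1) (fun q hq => key q (component_subset_ext hp hq))

/-- The plane as the complex numbers. -/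
def toC : (ℝ × ℝ) ≃L[ℝ] ℂ := Complex.equivRealProdCLM.symm

theorem exists_far {S : Set (ℝ × ℝ)} (hS : IsCompact S) :
    ∃ M : ℝ, ∀ z : ℝ × ℝ, M ≤ ‖toC z‖ → z ∈ extSet S := by
  obtain ⟨M, hM⟩ := (hS.image toC.continuous).isBounded.exists_norm_le
  refine ⟨max (M + 1) 1, fun z hz => ?_⟩
  have hz1 : M + 1 ≤ ‖toC z‖ := (le_max_left _ _).trans hz
  have hz2 : 1 ≤ ‖toC z‖ := (le_max_right _ _).trans hz
  have hray : (fun t : ℝ => t • z) '' Set.Ici 1 ⊆ Sᶜ := by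
    rintro _ ⟨t, ht, rfl⟩ hmem
    have h1 := hM _ (Set.mem_image_of_mem toC hmem)
    have ht' : (1 : ℝ) ≤ t := ht
    simp only [map_smul, norm_smul, Real.norm_eq_abs] at h1
    rw [abs_of_pos (by linarith)] at h1
    nlinarith
  have hz0 : z ∈ (fun t : ℝ => t • z) '' Set.Ici 1 := ⟨1, by simp, by simp⟩
  refine ⟨hray hz0, fun hb => ?_⟩
  have hpre : IsPreconnected ((fun t : ℝ => t • z) '' Set.Ici 1) :=
    isPreconnected_Ici.image _ (by fun_prop)
  have hb' := hb.subset (hpre.subset_connectedComponentIn hz0 hray)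
  obtain ⟨N, hN⟩ := hb'.exists_norm_le
  have hzpos : 0 < ‖z‖ := by
    rw [norm_pos_iff]
    rintro rfl
    simp at hz2
    linarith
  have h2 := hN ((max 1 ((N + 1) / ‖z‖)) • z) ⟨_, by simp, rfl⟩
  rw [norm_smul, Real.norm_eq_abs, abs_of_pos (lt_of_lt_of_le one_pos (le_max_left _ _))] at h2
  have h3 : (N + 1) / ‖z‖ * ‖z‖ ≤ N :=
    (mul_le_mul_of_nonneg_right (le_max_right _ _) hzpos.le).trans h2
  rw [div_mul_cancel₀ _ hzpos.ne'] at h3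
  linarith

theorem exists_log {A : Type} [TopologicalSpace A] [SimplyConnectedSpace A]
    [LocallyPathConnectedSpace A] (f : A → ℂ) (hf : Continuous f) (h0 : ∀ a, f a ≠ 0) :
    ∃ F : A → ℂ, Continuous F ∧ ∀ a, Complex.exp (F a) = f a := by
  obtain ⟨a₀⟩ : Nonempty A := inferInstance
  obtain ⟨F, ⟨-, hF⟩, -⟩ :=
    Complex.isCoveringMapOn_exp.existsUnique_continuousMap_lifts (⟨f, hf⟩ : C(A, ℂ)) (a₀ := a₀)
      (e₀ := Complex.log (f a₀)) (Complex.exp_log (h0 a₀)) (fun a => h0 a)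
  exact ⟨F, F.continuous, fun a => congrFun hF a⟩

/-- There is a continuous branch of `log (z - p)` on `S`. -/
def HasLog (p : ℝ × ℝ) (S : Set (ℝ × ℝ)) : Prop :=
  ∃ g : ℝ × ℝ → ℂ, ContinuousOn g S ∧ ∀ z ∈ S, Complex.exp (g z) = toC z - toC p

theorem hasLog_arc (p : ℝ × ℝ) (γ : unitInterval → ℝ × ℝ) (hγ : Continuous γ)
    (hi : Function.Injective γ) (s t : unitInterval) (hst : s ≤ t)
    (hp : ∀ x ∈ Set.Icc s t, γ x ≠ p) : HasLog p (γ '' Set.Icc s t) := by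
  let cl : ℝ → unitInterval := fun x => max s (min t (Set.projIcc 0 1 zero_le_one x))
  have hcl : Continuous cl := by
    have := continuous_projIcc (a := (0 : ℝ)) (b := 1) (h := zero_le_one)
    exact continuous_const.max (continuous_const.min this)
  have hclm : ∀ x, cl x ∈ Set.Icc s t := fun x =>
    ⟨le_max_left _ _, max_le hst (min_le_left _ _)⟩
  obtain ⟨F, hFc, hF⟩ := exists_log (fun x => toC (γ (cl x)) - toC p)
    ((toC.continuous.comp (hγ.comp hcl)).sub continuous_const)
    (fun x h => hp _ (hclm x) (toC.injective (sub_eq_zero.1 h)))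
  obtain ⟨g, hg⟩ := ContinuousMap.exists_extension' (hγ.isClosedEmbedding hi)
    (⟨fun x : unitInterval => F x, hFc.comp continuous_subtype_val⟩ : C(unitInterval, ℂ))
  refine ⟨g, g.continuous.continuousOn, ?_⟩
  rintro _ ⟨x, hx, rfl⟩
  have h1 : g (γ x) = F x := congrFun hg x
  have h2 : cl x = x := by
    simp only [cl, Set.projIcc_val]
    rw [min_eq_right hx.2, max_eq_right hx.1]
  rw [h1, hF, h2]

theorem HasLog.union {p : ℝ × ℝ} {A B : Set (ℝ × ℝ)} (hA : HasLog p A) (hB : HasLog p B)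
    (cA : IsClosed A) (cB : IsClosed B) (hAB : (A ∩ B).Subsingleton) : HasLog p (A ∪ B) := by
  classical
  obtain ⟨f, fc, hf⟩ := hA
  obtain ⟨g, gc, hg⟩ := hB
  obtain ⟨k, hk, hkk⟩ : ∃ k : ℂ, Complex.exp k = 1 ∧ ∀ z ∈ A ∩ B, f z = g z + k := by
    by_cases hne : (A ∩ B).Nonempty
    · obtain ⟨q, hq⟩ := hne
      refine ⟨f q - g q, ?_, ?_⟩
      · rw [Complex.exp_sub, hf q hq.1, hg q hq.2, div_self]
        rw [← hg q hq.2]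
        exact Complex.exp_ne_zero _
      · intro z hz
        rw [hAB hz hq]
        ring
    · exact ⟨0, by simp, fun z hz => (hne ⟨z, hz⟩).elim⟩
  refine ⟨fun z => if z ∈ A then f z else g z + k, ?_, ?_⟩
  · refine ContinuousOn.union_of_isClosed ?_ ?_ cA cB
    · exact fc.congr fun z hz => by simp [hz]
    · refine (gc.add (continuousOn_const (c := k))).congr fun z hz => ?_
      by_cases hzA : z ∈ A
      · simp [hzA, hkk z ⟨hzA, hz⟩]
      · simp [hzA]
  · intro z hz
    by_cases hzA : z ∈ A
    · simp [hzA, hf z hzA]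
    · have hzB : z ∈ B := hz.resolve_left hzA
      simp [hzA, Complex.exp_add, hk, hg z hzB]

theorem no_log {E A : Set (ℝ × ℝ)} {p : ℝ × ℝ} (M : ℝ)
    (hM : ∀ z : ℝ × ℝ, M ≤ ‖toC z‖ → z ∈ E) (hp : p ∉ closure E) (hA : IsClosed A)
    (hEA : frontier E ⊆ A) (hlog : HasLog p A) : False := by
  classical
  obtain ⟨g, gc, hg⟩ := hlog
  obtain ⟨G, hG⟩ := ContinuousMap.exists_restrict_eq hA
    (⟨A.domRestrict g, gc.domRestrict⟩ : C(A, ℂ))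
  have hG' : ∀ z ∈ A, G z = g z := fun z hz => congrArg (fun f : C(A, ℂ) => f ⟨z, hz⟩) hG
  let h : ℝ × ℝ → ℂ := fun z => if z ∈ closure E then toC z - toC p else Complex.exp (G z)
  have hc : Continuous h := by
    refine Continuous.if ?_ (toC.continuous.sub continuous_const)
      (Complex.continuous_exp.comp G.continuous)
    intro z hz
    have hzA : z ∈ A := hEA (frontier_closure_subset hz)
    rw [hG' z hzA, hg z hzA]
  have h0 : ∀ z, h z ≠ 0 := by
    intro z
    by_cases hz : z ∈ closure E
    · simp only [h, hz, if_true]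
      intro h'
      apply hp
      rw [← toC.injective (sub_eq_zero.1 h')]
      exact hz
    · simp only [h, hz, if_false]
      exact Complex.exp_ne_zero _
  obtain ⟨F, hFc, hF⟩ := exists_log h hc h0
  let ρ : ℝ := |M| + ‖toC p‖ + 1
  have hρ : 0 < ρ := by positivity
  let z : ℝ → ℝ × ℝ := fun θ => toC.symm (toC p + Complex.exp (Real.log ρ + θ * Complex.I))
  have hzc : Continuous z := by
    refine toC.symm.continuous.comp ?_
    fun_prop
  have hzE : ∀ θ, Complex.exp (F (z θ)) = Complex.exp (Real.log ρ + θ * Complex.I) := by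
    intro θ
    have hn : ‖Complex.exp (Real.log ρ + θ * Complex.I)‖ = ρ := by
      rw [Complex.norm_exp]
      simp [Real.exp_log hρ]
    have hzE : z θ ∈ E := by
      apply hM
      have h1 := norm_sub_le (toC p + Complex.exp (Real.log ρ + θ * Complex.I)) (toC p)
      rw [add_sub_cancel_left, hn] at h1
      simp only [z, ContinuousLinearEquiv.apply_symm_apply]
      have := le_abs_self M
      simp only [ρ] at h1
      linarith
    rw [hF]
    simp only [h, subset_closure hzE, if_true]
    simp [z]
  have hunique := Complex.isCoveringMap_exp.eq_of_comp_eq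
    (g₁ := fun θ : ℝ => F (z θ) - F (z 0))
    (g₂ := fun θ : ℝ => (θ : ℂ) * Complex.I)
    (by fun_prop) (by fun_prop) (by
      funext θ
      apply Subtype.ext
      simp only [Function.comp]
      rw [Complex.exp_sub, hzE, hzE, ← Complex.exp_sub]
      congr 1
      simp) 0 (by simp)
  have h2 := congrFun hunique (2 * Real.pi)
  have hz2 : z (2 * Real.pi) = z 0 := by
    simp only [z]
    congr 2
    rw [Complex.exp_add, Complex.exp_add]
    simp [Complex.exp_two_pi_mul_I]
  simp only [hz2, sub_self] at h2
  have := Real.pi_ne_zero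
  simp [Complex.ext_iff] at h2

theorem arc_subset_closure (γ : unitInterval → ℝ × ℝ) (hγ : Continuous γ)
    (hi : Function.Injective γ) (B C D : Set (ℝ × ℝ)) (cB : IsCompact B) (cC : IsCompact C)
    (cD : IsCompact D) (lB : ∀ p, p ∉ B → HasLog p B) (lC : ∀ p, p ∉ C → HasLog p C)
    (lD : ∀ p, p ∉ D → HasLog p D) (hBC : (B ∩ C).Subsingleton)
    (hBCD : ((B ∪ C) ∩ D).Subsingleton)
    (hγR : ∀ t, γ t ∈ B ∪ C ∪ D → t = 0 ∨ t = 1) :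
    Set.range γ ⊆ closure (extSet (Set.range γ ∪ (B ∪ C ∪ D))) := by
  set R := B ∪ C ∪ D with hR
  set S := Set.range γ ∪ R with hS
  have cR : IsCompact R := (cB.union cC).union cD
  have cS : IsCompact S := (isCompact_range hγ).union cR
  have key : ∀ t : unitInterval, t ∈ Set.Ioo (0 : unitInterval) 1 →
      γ t ∈ closure (extSet S) := by
    intro t ht
    by_contra hcl
    have hnear : γ ⁻¹' (closure (extSet S))ᶜ ∈ nhds t :=
      (isClosed_closure.isOpen_compl.preimage hγ).mem_nhds hcl
    obtain ⟨s, u, hsu, hnb, hsub⟩ :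
        ∃ s u : unitInterval, t ∈ Set.Ioo s u ∧ True ∧
          Set.Ioo s u ⊆ γ ⁻¹' (closure (extSet S))ᶜ := by
      obtain ⟨s, u, h1, h2⟩ := (mem_nhds_iff_exists_Ioo_subset' ⟨0, ht.1⟩ ⟨1, ht.2⟩).1 hnear
      exact ⟨s, u, h1, trivial, h2⟩
    have htR : γ t ∉ R := by
      intro h
      rcases hγR t h with h | h
      · exact ht.1.ne' h
      · exact ht.2.ne h
    have hs1 : s < 1 := lt_of_lt_of_le hsu.1 ht.2.le
    have hu0 : 0 < u := lt_of_le_of_lt ht.1.le hsu.2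
    have c1 : IsClosed (γ '' Set.Icc 0 s) := (isCompact_Icc.image hγ).isClosed
    have c2 : IsClosed (γ '' Set.Icc u 1) := (isCompact_Icc.image hγ).isClosed
    have l1 : HasLog (γ t) (γ '' Set.Icc 0 s) := hasLog_arc _ γ hγ hi 0 s unitInterval.nonneg'
      (fun x hx h => absurd (hi h) (lt_of_le_of_lt hx.2 hsu.1).ne)
    have l2 : HasLog (γ t) (γ '' Set.Icc u 1) := hasLog_arc _ γ hγ hi u 1 unitInterval.le_one'
      (fun x hx h => absurd (hi h) (lt_of_lt_of_le hsu.2 hx.1).ne')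
    have lR : HasLog (γ t) R := by
      have hb : γ t ∉ B := fun h => htR (Or.inl (Or.inl h))
      have hc : γ t ∉ C := fun h => htR (Or.inl (Or.inr h))
      have hd : γ t ∉ D := fun h => htR (Or.inr h)
      exact ((lB _ hb).union (lC _ hc) cB.isClosed cC.isClosed hBC).union (lD _ hd)
        (cB.isClosed.union cC.isClosed) cD.isClosed hBCD
    have lR1 : HasLog (γ t) (R ∪ γ '' Set.Icc 0 s) := by
      refine lR.union l1 cR.isClosed c1 ?_
      have : ∀ z ∈ R ∩ γ '' Set.Icc 0 s, z = γ 0 := by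
        rintro _ ⟨hz, x, hx, rfl⟩
        rcases hγR x hz with h | h
        · rw [h]
        · exact absurd h (lt_of_le_of_lt hx.2 hs1).ne
      intro y hy z hz
      rw [this y hy, this z hz]
    have lR2 : HasLog (γ t) ((R ∪ γ '' Set.Icc 0 s) ∪ γ '' Set.Icc u 1) := by
      refine lR1.union l2 (cR.isClosed.union c1) c2 ?_
      have : ∀ z ∈ (R ∪ γ '' Set.Icc 0 s) ∩ γ '' Set.Icc u 1, z = γ 1 := by
        rintro _ ⟨hz | ⟨y, hy, hyx⟩, x, hx, rfl⟩
        · rcases hγR x hz with h | h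
          · exact absurd h (lt_of_lt_of_le hu0 hx.1).ne'
          · rw [h]
        · have := hi hyx
          subst this
          exact absurd (hx.1.trans hy.2) (not_le.2 (hsu.1.trans hsu.2))
      intro y hy z hz
      rw [this y hy, this z hz]
    obtain ⟨M, hM⟩ := exists_far cS
    refine no_log M hM hcl ((cR.isClosed.union c1).union c2) ?_ lR2
    intro z hz
    rcases frontier_ext_subset cS.isClosed hz with ⟨x, rfl⟩ | h
    · by_cases hxs : x ≤ s
      · exact Or.inl (Or.inr ⟨x, ⟨unitInterval.nonneg', hxs⟩, rfl⟩)
      · by_cases hxu : u ≤ x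
        · exact Or.inr ⟨x, ⟨hxu, unitInterval.le_one'⟩, rfl⟩
        · exact absurd hz.1 (hsub ⟨not_le.1 hxs, not_le.1 hxu⟩)
    · exact Or.inl (Or.inl h)
  have hdense : closure (Set.Ioo (0 : unitInterval) 1) = Set.univ := by
    rw [closure_Ioo zero_ne_one]
    ext x
    simp [unitInterval.le_one']
  rintro _ ⟨t, rfl⟩
  have ht : t ∈ closure (Set.Ioo (0 : unitInterval) 1) := by rw [hdense]; trivial
  have hsub : Set.Ioo (0 : unitInterval) 1 ⊆ γ ⁻¹' closure (extSet S) := key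
  exact closure_minimal hsub (isClosed_closure.preimage hγ) ht

/-! ### Drawings -/

namespace Drawing

theorem vertex_mem_arcSet {V : Type} {G : SimpleGraph V} (D : Drawing G) {u v w : V}
    (h : G.Adj u v) (hw : D.pos w ∈ D.arcSet h) : w = u ∨ w = v := by
  obtain ⟨t, ht⟩ := hw
  rcases D.arc_vertex h t w ht with rfl | rfl
  · left
    apply D.pos_inj
    rw [← ht, Path.source]
  · right
    apply D.pos_inj
    rw [← ht, Path.target]

theorem left_mem_arcSet {V : Type} {G : SimpleGraph V} (D : Drawing G) {u v : V}
    (h : G.Adj u v) : D.pos u ∈ D.arcSet h := ⟨0, Path.source _⟩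

theorem right_mem_arcSet {V : Type} {G : SimpleGraph V} (D : Drawing G) {u v : V}
    (h : G.Adj u v) : D.pos v ∈ D.arcSet h := ⟨1, Path.target _⟩

theorem arcSet_symm {V : Type} {G : SimpleGraph V} (D : Drawing G) {u v : V}
    (h : G.Adj u v) : D.arcSet h.symm = D.arcSet h := by
  unfold arcSet
  rw [D.arc_symm h, Path.symm_range]

theorem arcSet_congr {V : Type} {G : SimpleGraph V} (D : Drawing G) {u v x y : V}
    (h : G.Adj u v) (h' : G.Adj x y) (he : s(u, v) = s(x, y)) : D.arcSet h = D.arcSet h' := by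
  rcases Sym2.eq_iff.1 he with ⟨rfl, rfl⟩ | ⟨rfl, rfl⟩
  · rfl
  · exact (D.arcSet_symm h').symm ▸ rfl

theorem arcSet_compact {V : Type} {G : SimpleGraph V} (D : Drawing G) {u v : V}
    (h : G.Adj u v) : IsCompact (D.arcSet h) := isCompact_range (D.arc h).continuous

theorem arcSet_subset {V : Type} {G : SimpleGraph V} (D : Drawing G) {u v : V}
    (h : G.Adj u v) : D.arcSet h ⊆ D.graphSet := by
  intro p hp
  right
  simp only [mem_iUnion]
  exact ⟨u, v, h, hp⟩

theorem graphSet_closed {V : Type} [Finite V] {G : SimpleGraph V} (D : Drawing G) :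
    IsClosed D.graphSet := by
  refine (Set.finite_range _).isClosed.union ?_
  refine isClosed_iUnion_of_finite fun u => isClosed_iUnion_of_finite fun v => ?_
  exact isClosed_iUnion_of_finite fun h => (D.arcSet_compact h).isClosed

theorem arcSet_hasLog {V : Type} {G : SimpleGraph V} (D : Drawing G) {u v : V}
    (h : G.Adj u v) (p : ℝ × ℝ) (hp : p ∉ D.arcSet h) : HasLog p (D.arcSet h) := by
  have := hasLog_arc p (D.arc h) (D.arc h).continuous (D.arc_inj h) 0 1 zero_le_one
    (fun x _ hx => hp ⟨x, hx⟩)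
  have hu : Set.Icc (0 : unitInterval) 1 = Set.univ := by
    ext x
    simp [unitInterval.le_one']
  rwa [hu, Set.image_univ] at this

theorem plane_meet {V : Type} {G : SimpleGraph V} (D : Drawing G) (hD : D.IsPlane)
    {u v x y : V} (h : G.Adj u v) (h' : G.Adj x y) (hne : s(u, v) ≠ s(x, y))
    (t : unitInterval) (ht : D.arc h t ∈ D.arcSet h') : t = 0 ∨ t = 1 := by
  obtain ⟨t', ht'⟩ := ht
  by_contra hcon
  push Not at hcon
  by_cases h0 : t' = 0
  · subst h0
    rw [Path.source] at ht'
    exact absurd (D.arc_vertex h t _ ht'.symm) (by tauto)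
  by_cases h1 : t' = 1
  · subst h1
    rw [Path.target] at ht'
    exact absurd (D.arc_vertex h t _ ht'.symm) (by tauto)
  have hcr := hD (D.arc h t)
  exact hcr ⟨u, v, x, y, h, h', hne, ⟨t, hcon, rfl⟩, t', ⟨h0, h1⟩, by rw [ht']⟩


theorem plane_meet' {V : Type} {G : SimpleGraph V} (D : Drawing G) (hD : D.IsPlane)
    {u v x y : V} (h : G.Adj u v) (h' : G.Adj x y) (hne : s(u, v) ≠ s(x, y))
    (p : ℝ × ℝ) (hp : p ∈ D.arcSet h) (hp' : p ∈ D.arcSet h') :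
    ∃ w, p = D.pos w ∧ (w = u ∨ w = v) ∧ (w = x ∨ w = y) := by
  obtain ⟨t, rfl⟩ := hp
  rcases D.plane_meet hD h h' hne t hp' with rfl | rfl
  · rw [Path.source] at hp' ⊢
    exact ⟨u, rfl, Or.inl rfl, D.vertex_mem_arcSet h' hp'⟩
  · rw [Path.target] at hp' ⊢
    have hfin := D.vertex_mem_arcSet h' hp'
    exact ⟨v, rfl, Or.inr rfl, hfin⟩

/-- Restriction of a drawing to a subgraph. -/
def sub {V W : Type} {G : SimpleGraph V} (D : Drawing G) (f : W ↪ V) (H : SimpleGraph W)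
    (hH : ∀ ⦃i j : W⦄, H.Adj i j → G.Adj (f i) (f j)) : Drawing H where
  pos i := D.pos (f i)
  pos_inj := D.pos_inj.comp f.injective
  arc _ _ h := D.arc (hH h)
  arc_symm _ _ h := D.arc_symm (hH h)
  arc_inj _ _ h := D.arc_inj (hH h)
  arc_vertex _ _ h t w hw := D.arc_vertex (hH h) t (f w) hw
  arc_meet_once u v x y h₁ h₂ hne := by
    refine D.arc_meet_once (hH h₁) (hH h₂) fun h => hne ?_
    have hi := f.injective
    simp only [Sym2.eq_iff, hi.eq_iff] at h ⊢
    exact h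
  arc_no_triple u₁ v₁ u₂ v₂ u₃ v₃ h₁ h₂ h₃ n1 n2 n3 p hp := by
    have hi := f.injective
    obtain ⟨w, hw⟩ := D.arc_no_triple (hH h₁) (hH h₂) (hH h₃)
      (fun h => n1 (by simp only [Sym2.eq_iff, hi.eq_iff] at h ⊢; exact h))
      (fun h => n2 (by simp only [Sym2.eq_iff, hi.eq_iff] at h ⊢; exact h))
      (fun h => n3 (by simp only [Sym2.eq_iff, hi.eq_iff] at h ⊢; exact h)) p hp
    have hm : D.pos w ∈ D.arcSet (hH h₁) := hw ▸ hp.1.1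
    rcases D.vertex_mem_arcSet _ hm with rfl | rfl
    · exact ⟨u₁, hw⟩
    · exact ⟨v₁, hw⟩

section Sub

variable {V W : Type} {G : SimpleGraph V} (D : Drawing G) (f : W ↪ V) (H : SimpleGraph W)
    (hH : ∀ ⦃i j : W⦄, H.Adj i j → G.Adj (f i) (f j))

theorem sub_plane (hD : D.IsPlane) : (D.sub f H hH).IsPlane := by
  rintro p ⟨u, v, x, y, h₁, h₂, hne, hp1, hp2⟩
  refine hD p ⟨f u, f v, f x, f y, hH h₁, hH h₂, fun h => hne ?_, hp1, hp2⟩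
  have hi := f.injective
  simp only [Sym2.eq_iff, hi.eq_iff] at h ⊢
  exact h

theorem sub_graphSet : (D.sub f H hH).graphSet ⊆ D.graphSet := by
  rintro p (⟨i, rfl⟩ | hp)
  · exact Or.inl ⟨f i, rfl⟩
  · simp only [mem_iUnion] at hp
    obtain ⟨u, v, h, hp⟩ := hp
    exact D.arcSet_subset (hH h) hp

theorem sub_frontier {p : ℝ × ℝ} (hp : p ∈ frontier D.outerFace)
    (hp' : p ∈ (D.sub f H hH).graphSet) : p ∈ frontier (D.sub f H hH).outerFace :=
  mem_frontier_ext (closure_mono (ext_anti (D.sub_graphSet f H hH)) hp.1) hp'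

theorem walkSet_subset_graphSet {a b : V} (w : G.Walk a b) : D.walkSet w ⊆ D.graphSet := by
  rintro p (⟨v, -, rfl⟩ | hp)
  · exact Or.inl ⟨v, rfl⟩
  · simp only [mem_iUnion] at hp
    obtain ⟨d, -, hp⟩ := hp
    exact D.arcSet_subset d.adj hp

theorem walkSet_cons {a b c : V} (h : G.Adj a b) (w : G.Walk b c) :
    D.walkSet (.cons h w) = D.arcSet h ∪ D.walkSet w := by
  have h1 := D.left_mem_arcSet h
  ext p
  simp only [walkSet, SimpleGraph.Walk.support_cons, SimpleGraph.Walk.darts_cons, mem_union,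
    mem_image, mem_ofPred_eq, List.mem_cons, mem_iUnion, exists_prop]
  constructor
  · rintro (⟨v, rfl | hv, rfl⟩ | ⟨d, rfl | hd, hp⟩)
    · exact Or.inl h1
    · exact Or.inr (Or.inl ⟨v, hv, rfl⟩)
    · exact Or.inl hp
    · exact Or.inr (Or.inr ⟨d, hd, hp⟩)
  · rintro (hp | ⟨v, hv, rfl⟩ | ⟨d, hd, hp⟩)
    · exact Or.inr ⟨_, Or.inl rfl, hp⟩
    · exact Or.inl ⟨v, Or.inr hv, rfl⟩
    · exact Or.inr ⟨d, Or.inr hd, hp⟩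

theorem walkSet_nil {a : V} : D.walkSet (.nil : G.Walk a a) = {D.pos a} := by
  simp [walkSet]

theorem exists_sub_walk (hH' : ∀ ⦃i j : W⦄, G.Adj (f i) (f j) → H.Adj i j) {a b : V}
    (w : G.Walk a b) : (∀ v ∈ w.support, v ∈ Set.range f) → ∀ a', f a' = a →
    ∃ (b' : W) (w' : H.Walk a' b'), w'.support.map f = w.support ∧
      w'.length = w.length ∧ (D.sub f H hH).walkSet w' = D.walkSet w := by
  induction w with
  | nil =>
    rintro - a' rfl
    exact ⟨a', .nil, by simp, rfl, by rw [walkSet_nil, walkSet_nil]; rfl⟩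
  | @cons u v x h w ih =>
    rintro hs a' rfl
    obtain ⟨v', rfl⟩ := hs v (by simp)
    obtain ⟨b', w', h1, h2, h3⟩ := ih (fun y hy => hs y (by simp [hy])) v' rfl
    refine ⟨b', .cons (hH' h) w', by simp [h1], by simp [h2], ?_⟩
    rw [walkSet_cons, walkSet_cons, h3]
    rfl

end Sub

end Drawing

theorem sub_size_lt {n : ℕ} (G : SimpleGraph (Fin n)) (S : Finset (Fin n)) (x : Fin n)
    (hx : x ∉ S) (f : Fin S.card ↪ Fin n) (H : SimpleGraph (Fin S.card))
    (hH : ∀ ⦃i j⦄, H.Adj i j → G.Adj (f i) (f j)) :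
    S.card + H.edgeSet.ncard < n + G.edgeSet.ncard := by
  have h1 : S.card < n := by
    have := Finset.card_lt_univ_of_notMem hx
    simpa using this
  have h2 : H.edgeSet.ncard ≤ G.edgeSet.ncard := by
    refine Set.ncard_le_ncard_of_injOn (Sym2.map f) ?_
      (Sym2.map.injective f.injective).injOn (Set.toFinite _)
    intro e he
    induction e with
    | _ u v => exact hH he
  omega

/-- The increasing enumeration of a finite set of vertices. -/
def enumEmb {n : ℕ} (S : Finset (Fin n)) : Fin S.card ↪ Fin n :=
  (S.orderEmbOfFin rfl).toEmbedding

theorem enumEmb_mem {n : ℕ} (S : Finset (Fin n)) (i : Fin S.card) : enumEmb S i ∈ S :=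
  S.orderEmbOfFin_mem rfl i

theorem enumEmb_surj {n : ℕ} (S : Finset (Fin n)) {v : Fin n} (hv : v ∈ S) :
    ∃ i, enumEmb S i = v := by
  have : v ∈ Set.range (S.orderEmbOfFin rfl) := by
    rw [Finset.range_orderEmbOfFin]
    exact hv
  exact this

theorem induced_colorable (C : Config) (hmin : C.Minimal) (S : Finset (Fin C.n))
    (hP : ∀ v ∈ C.P.support, v ∈ S) (x : Fin C.n) (hx : x ∉ S) :
    ∃ φ : Fin C.n → ℕ, (∀ v ∈ S, φ v ∈ C.L v) ∧
      ∀ u ∈ S, ∀ v ∈ S, C.G.Adj u v → φ u ≠ φ v := by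
  by_contra hcon
  let f := enumEmb S
  let H : SimpleGraph (Fin S.card) := C.G.comap f
  have hH : ∀ ⦃i j⦄, H.Adj i j → C.G.Adj (f i) (f j) := fun i j h => h
  obtain ⟨a', ha'⟩ := enumEmb_surj S (hP C.a (by simp))
  obtain ⟨b', P', hs, hl, hw⟩ := C.D.exists_sub_walk f H hH (fun i j h => h) C.P
    (fun v hv => enumEmb_surj S (hP v hv)) a' ha'
  have hsup : ∀ i, i ∈ P'.support ↔ f i ∈ C.P.support := by
    intro i
    rw [← hs]
    exact (List.mem_map_of_injective f.injective).symm
  have hout : ∀ i, C.D.OnOuter (f i) → (C.D.sub f H hH).OnOuter i := fun i h =>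
    C.D.sub_frontier f H hH h (Or.inl ⟨i, rfl⟩)
  let C' : Config :=
    { n := S.card
      G := H
      D := C.D.sub f H hH
      plane := C.D.sub_plane f H hH C.plane
      a := a'
      b := b'
      P := P'
      P_path := by
        rw [SimpleGraph.Walk.isPath_def]
        have := C.P_path.support_nodup
        rw [← hs] at this
        exact List.Nodup.of_map f this
      P_len := hl ▸ C.P_len
      P_boundary := by
        intro p hp
        exact C.D.sub_frontier f H hH (C.P_boundary (hw ▸ hp))
          (Drawing.walkSet_subset_graphSet _ _ hp)
      L := fun i => C.L (f i)
      size5 := fun i hi => C.size5 _ fun h => hi (hout i h)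
      size3 := by
        intro i _ hi
        by_cases h : C.D.OnOuter (f i)
        · exact C.size3 _ h fun h' => hi ((hsup i).2 h')
        · exact (by norm_num : 3 ≤ 5).trans (C.size5 _ h)
      size1 := fun i hi => C.size1 _ ((hsup i).1 hi)
      no_adjacent_3 := fun i j h => C.no_adjacent_3 _ _ (hH h)
      proper_on_P := fun i hi j hj h =>
        C.proper_on_P _ ((hsup i).1 hi) _ ((hsup j).1 hj) (hH h)
      common_neighbor := by
        intro p₀ p₁ p₂ hp y h0 h1 h2
        refine C.common_neighbor (f p₀) (f p₁) (f p₂) ?_ (f y) h0 h1 h2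
        rw [← hs, hp]
        rfl
      not_colorable := by
        rintro ⟨c, hc1, hc2⟩
        apply hcon
        refine ⟨Function.extend f c 0, ?_, ?_⟩
        · intro v hv
          obtain ⟨i, rfl⟩ := enumEmb_surj S hv
          have : Function.extend f c 0 (f i) = c i := f.injective.extend_apply _ _ _
          change Function.extend f c 0 (f i) ∈ C.L (f i)
          rw [this]
          exact hc1 i
        · intro u hu v hv huv
          obtain ⟨i, rfl⟩ := enumEmb_surj S hu
          obtain ⟨j, rfl⟩ := enumEmb_surj S hv
          have e1 : Function.extend f c 0 (f i) = c i := f.injective.extend_apply _ _ _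
          have e2 : Function.extend f c 0 (f j) = c j := f.injective.extend_apply _ _ _
          change Function.extend f c 0 (f i) ≠ Function.extend f c 0 (f j)
          rw [e1, e2]
          exact hc2 huv }
  have h1 := hmin.1 C'
  have h2 := sub_size_lt C.G S x hx f H hH
  exact absurd h1 (not_le.2 h2)

/-! ### The 4-cycle -/

section FourCycle

variable {V : Type} {G : SimpleGraph V} (D : Drawing G) {a b c d : V}
  (hab : G.Adj a b) (hbc : G.Adj b c) (hcd : G.Adj c d) (hda : G.Adj d a)

/-- The drawing of a 4-cycle. -/
def fourSet : Set (ℝ × ℝ) :=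
  D.arcSet hab ∪ (D.arcSet hbc ∪ D.arcSet hcd ∪ D.arcSet hda)

theorem fourSet_compact : IsCompact (fourSet D hab hbc hcd hda) :=
  (D.arcSet_compact hab).union
    (((D.arcSet_compact hbc).union (D.arcSet_compact hcd)).union (D.arcSet_compact hda))

theorem fourSet_rotate : fourSet D hbc hcd hda hab = fourSet D hab hbc hcd hda := by
  ext p
  simp only [fourSet, mem_union]
  tauto

theorem fourSet_vertex {w : V} (hw : D.pos w ∈ fourSet D hab hbc hcd hda) :
    w = a ∨ w = b ∨ w = c ∨ w = d := by
  rcases hw with h | (h | h) | h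
  all_goals
    rcases D.vertex_mem_arcSet _ h with h | h <;> simp [h]

theorem four_arc_closure (hD : D.IsPlane) (hac : a ≠ c) (hbd : b ≠ d) :
    D.arcSet hab ⊆ closure (extSet (fourSet D hab hbc hcd hda)) := by
  have nab := hab.ne
  have nbc := hbc.ne
  have ncd := hcd.ne
  have nda := hda.ne
  refine arc_subset_closure (D.arc hab) (D.arc hab).continuous (D.arc_inj hab) _ _ _
    (D.arcSet_compact hbc) (D.arcSet_compact hcd) (D.arcSet_compact hda)
    (fun p hp => D.arcSet_hasLog hbc p hp) (fun p hp => D.arcSet_hasLog hcd p hp)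
    (fun p hp => D.arcSet_hasLog hda p hp) ?_ ?_ ?_
  · exact D.arc_meet_once hbc hcd (by simp only [ne_eq, Sym2.eq_iff]; grind)
  · have : ∀ p ∈ (D.arcSet hbc ∪ D.arcSet hcd) ∩ D.arcSet hda, p = D.pos d := by
      rintro p ⟨h1 | h1, h2⟩
      · obtain ⟨w, rfl, h3, h4⟩ := D.plane_meet' hD hbc hda
          (by simp only [ne_eq, Sym2.eq_iff]; grind) p h1 h2
        grind
      · obtain ⟨w, rfl, h3, h4⟩ := D.plane_meet' hD hcd hda
          (by simp only [ne_eq, Sym2.eq_iff]; grind) p h1 h2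
        grind
    intro p hp q hq
    rw [this p hp, this q hq]
  · rintro t ((h | h) | h)
    · exact D.plane_meet hD hab hbc (by simp only [ne_eq, Sym2.eq_iff]; grind) t h
    · exact D.plane_meet hD hab hcd (by simp only [ne_eq, Sym2.eq_iff]; grind) t h
    · exact D.plane_meet hD hab hda (by simp only [ne_eq, Sym2.eq_iff]; grind) t h

theorem four_closure (hD : D.IsPlane) (hac : a ≠ c) (hbd : b ≠ d) :
    fourSet D hab hbc hcd hda ⊆ closure (extSet (fourSet D hab hbc hcd hda)) := by
  have r1 := fourSet_rotate D hab hbc hcd hda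
  have r2 := fourSet_rotate D hbc hcd hda hab
  have r3 := fourSet_rotate D hcd hda hab hbc
  rintro p (h | (h | h) | h)
  · exact four_arc_closure D hab hbc hcd hda hD hac hbd h
  · have := four_arc_closure D hbc hcd hda hab hD hbd hac.symm h
    rwa [r1] at this
  · have := four_arc_closure D hcd hda hab hbc hD hac.symm hbd.symm h
    rwa [r2, r1] at this
  · have := four_arc_closure D hda hab hbc hcd hD hbd.symm hac h
    rwa [r3, r2, r1] at this

theorem preconn_half (γ : unitInterval → ℝ × ℝ) (hγ : Continuous γ) :
    IsPreconnected (γ '' {t | t ≠ 1}) := by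
  have : {t : unitInterval | t ≠ 1} = Set.Iio 1 := by
    ext t
    exact ⟨fun h => lt_of_le_of_ne unitInterval.le_one' h, fun h => ne_of_lt h⟩
  rw [this]
  exact isPreconnected_Iio.image _ hγ.continuousOn

/-- Edges with an end in the interior stay in the closed disc. -/
theorem inner_arc (hD : D.IsPlane) {u v : V} (h : G.Adj u v)
    (hu : D.pos u ∈ enclosed (fourSet D hab hbc hcd hda)) :
    D.arcSet h ⊆ fourSet D hab hbc hcd hda ∪ enclosed (fourSet D hab hbc hcd hda) := by
  set S := fourSet D hab hbc hcd hda with hS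
  have hu' : ∀ {x y : V} (h' : G.Adj x y), D.arcSet h' ⊆ S → s(u, v) ≠ s(x, y) := by
    intro x y h' hsub he
    refine hu.1 (hsub ?_)
    rw [← D.arcSet_congr h h' he]
    exact D.left_mem_arcSet h
  have hmeet : ∀ t, D.arc h t ∈ S → t = 1 := by
    intro t ht
    have h01 : t = 0 ∨ t = 1 := by
      rcases ht with h' | (h' | h') | h'
      · exact D.plane_meet hD h hab (hu' hab fun p hp => Or.inl hp) t h'
      · exact D.plane_meet hD h hbc (hu' hbc fun p hp => Or.inr (Or.inl (Or.inl hp))) t h'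
      · exact D.plane_meet hD h hcd (hu' hcd fun p hp => Or.inr (Or.inl (Or.inr hp))) t h'
      · exact D.plane_meet hD h hda (hu' hda fun p hp => Or.inr (Or.inr hp)) t h'
    rcases h01 with rfl | h1
    · rw [Path.source] at ht
      exact absurd ht hu.1
    · exact h1
  by_cases hv : D.pos v ∈ S
  · rintro _ ⟨t, rfl⟩
    by_cases ht : t = 1
    · left
      rw [ht, Path.target]
      exact hv
    · right
      refine enclosed_of_preconn (preconn_half (D.arc h) (D.arc h).continuous) ?_
        ⟨0, by simp, Path.source _⟩ ⟨t, ht, rfl⟩ hu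
      rintro _ ⟨t, ht, rfl⟩ hmem
      exact ht (hmeet t hmem)
  · rintro p hp
    right
    refine enclosed_of_preconn (isPreconnected_range (D.arc h).continuous) ?_
      (D.left_mem_arcSet h) hp hu
    rintro _ ⟨t, rfl⟩ hmem
    have := hmeet t hmem
    subst this
    rw [Path.target] at hmem
    exact hv hmem

theorem enclosed_not_onOuter (hD : D.IsPlane) {v : V}
    (hv : D.pos v ∈ enclosed (fourSet D hab hbc hcd hda)) : ¬ D.OnOuter v := by
  intro ho
  have hsub : fourSet D hab hbc hcd hda ⊆ D.graphSet :=
    union_subset (D.arcSet_subset _) (union_subset (union_subset (D.arcSet_subset _)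
      (D.arcSet_subset _)) (D.arcSet_subset _))
  obtain ⟨q, hq1, hq2⟩ := mem_closure_iff.1 ho.1 _
    (isOpen_enclosed (fourSet_compact D hab hbc hcd hda).isClosed) hv
  exact not_enclosed_of_ext (ext_anti hsub hq2) hq1

end FourCycle

theorem four_main (C : Config) (hmin : C.Minimal) {a b c d : Fin C.n}
    (hab : C.G.Adj a b) (hbc : C.G.Adj b c) (hcd : C.G.Adj c d) (hda : C.G.Adj d a)
    (hac : a ≠ c) (hbd : b ≠ d) (x : Fin C.n) :
    C.D.pos x ∉ enclosed (fourSet C.D hab hbc hcd hda) := by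
  classical
  intro hx
  set K := fourSet C.D hab hbc hcd hda with hK
  have nab := hab.ne
  have nbc := hbc.ne
  have ncd := hcd.ne
  have nda := hda.ne
  have abK : C.D.arcSet hab ⊆ K := fun p hp => Or.inl hp
  have bcK : C.D.arcSet hbc ⊆ K := fun p hp => Or.inr (Or.inl (Or.inl hp))
  have aK : C.D.pos a ∈ K := abK (C.D.left_mem_arcSet hab)
  have bK : C.D.pos b ∈ K := abK (C.D.right_mem_arcSet hab)
  have cK : C.D.pos c ∈ K := bcK (C.D.right_mem_arcSet hbc)
  have dK : C.D.pos d ∈ K := Or.inr (Or.inr (C.D.left_mem_arcSet hda))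
  have nK : ∀ {v}, C.D.pos v ∈ K → C.D.pos v ∉ enclosed K := fun h h' => h'.1 h
  have hKcl : IsClosed K := (fourSet_compact C.D hab hbc hcd hda).isClosed
  -- colour everything outside
  obtain ⟨φ, hφ1, hφ2⟩ := induced_colorable C hmin
    (Finset.univ.filter fun v => C.D.pos v ∉ enclosed K) (by
      intro v hv
      simp only [Finset.mem_filter, Finset.mem_univ, true_and]
      intro h
      exact enclosed_not_onOuter C.D hab hbc hcd hda C.plane h
        (C.P_boundary (Or.inl ⟨v, hv, rfl⟩))) x (by simpa using hx)
  simp only [Finset.mem_filter, Finset.mem_univ, true_and] at hφ1 hφ2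
  -- the inner graph
  let S : Finset (Fin C.n) := Finset.univ.filter fun v =>
    C.D.pos v ∈ enclosed K ∨ v = a ∨ v = b ∨ v = c
  have memS : ∀ v, v ∈ S ↔ C.D.pos v ∈ enclosed K ∨ v = a ∨ v = b ∨ v = c := by
    intro v
    simp [S]
  have hdS : d ∉ S := by
    rw [memS]
    rintro (h | h | h | h)
    · exact nK dK h
    · exact nda h
    · exact hbd h.symm
    · exact ncd h.symm
  let f := enumEmb S
  let Q : Fin C.n → Fin C.n → Prop := fun u v =>
    C.D.pos u ∈ enclosed K ∨ C.D.pos v ∈ enclosed K ∨ s(u, v) = s(a, b) ∨ s(u, v) = s(b, c)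
  have Qsymm : ∀ u v, Q u v → Q v u := by
    rintro u v (h | h | h | h)
    · exact Or.inr (Or.inl h)
    · exact Or.inl h
    · exact Or.inr (Or.inr (Or.inl (Sym2.eq_swap.trans h)))
    · exact Or.inr (Or.inr (Or.inr (Sym2.eq_swap.trans h)))
  let H : SimpleGraph (Fin S.card) :=
    { Adj := fun i j => C.G.Adj (f i) (f j) ∧ Q (f i) (f j)
      symm := ⟨fun i j h => ⟨h.1.symm, Qsymm _ _ h.2⟩⟩
      loopless := ⟨fun i h => C.G.irrefl h.1⟩ }
  have hH : ∀ ⦃i j⦄, H.Adj i j → C.G.Adj (f i) (f j) := fun i j h => h.1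
  let D' := C.D.sub f H hH
  have hfd : ∀ i, f i ≠ d := fun i h => hdS (h ▸ enumEmb_mem S i)
  have hD'K : D'.graphSet ⊆ K ∪ enclosed K := by
    rintro p (⟨i, rfl⟩ | hp)
    · change C.D.pos (f i) ∈ _
      rcases (memS _).1 (enumEmb_mem S i) with h | h | h | h
      · exact Or.inr h
      · exact Or.inl (by rw [show f i = a from h]; exact aK)
      · exact Or.inl (by rw [show f i = b from h]; exact bK)
      · exact Or.inl (by rw [show f i = c from h]; exact cK)
    · simp only [mem_iUnion] at hp
      obtain ⟨i, j, h, hp⟩ := hp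
      have hp : p ∈ C.D.arcSet (hH h) := hp
      rcases h.2 with h' | h' | h' | h'
      · exact inner_arc C.D hab hbc hcd hda C.plane (hH h) h' hp
      · rw [← C.D.arcSet_symm] at hp
        exact inner_arc C.D hab hbc hcd hda C.plane (hH h).symm h' hp
      · rw [C.D.arcSet_congr (hH h) hab h'] at hp
        exact Or.inl (abK hp)
      · rw [C.D.arcSet_congr (hH h) hbc h'] at hp
        exact Or.inl (bcK hp)
  have hext : extSet K ⊆ D'.outerFace := ext_subset_ext hD'K
  have hKcls : K ⊆ closure D'.outerFace :=
    (four_closure C.D hab hbc hcd hda C.plane hac hbd).trans (closure_mono hext)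
  have hD'cl : IsClosed D'.graphSet := D'.graphSet_closed
  -- arcs from `d` avoid the inner graph
  have havoid : ∀ {v} (h : C.G.Adj d v) (t : unitInterval), t ≠ 1 →
      C.D.arc h t ∉ D'.graphSet := by
    intro v h t ht hmem
    rcases hmem with ⟨i, hi⟩ | hp
    · have hi : C.D.pos (f i) = C.D.arc h t := hi
      rcases C.D.arc_vertex h t _ hi.symm with rfl | h1
      · rw [Path.source] at hi
        exact hfd i (C.D.pos_inj hi)
      · exact ht h1
    · simp only [mem_iUnion] at hp
      obtain ⟨i, j, h', hp⟩ := hp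
      have hp : C.D.arc h t ∈ C.D.arcSet (hH h') := hp
      have hne : s(d, v) ≠ s(f i, f j) := by
        intro he
        rcases Sym2.eq_iff.1 he with ⟨h1, -⟩ | ⟨h1, -⟩
        · exact hfd i h1.symm
        · exact hfd j h1.symm
      rcases C.D.plane_meet C.plane h (hH h') hne t hp with rfl | h1
      · rw [Path.source] at hp
        rcases C.D.vertex_mem_arcSet _ hp with h1 | h1
        · exact hfd i h1.symm
        · exact hfd j h1.symm
      · exact ht h1
  have hdout : C.D.pos d ∈ extSet D'.graphSet := by
    refine ext_of_closure hD'cl (hKcls dK) ?_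
    have := havoid hda 0 (by simp)
    rwa [Path.source] at this
  have hnbr : ∀ i, C.G.Adj d (f i) → D'.OnOuter i := by
    intro i h
    refine mem_frontier_ext ?_ (Or.inl ⟨i, rfl⟩)
    have hsub : {t : unitInterval | t ≠ 1} ⊆ (C.D.arc h) ⁻¹' closure (extSet D'.graphSet) := by
      intro t ht
      refine subset_closure (extSet_of_preconn
        (preconn_half (C.D.arc h) (C.D.arc h).continuous) ?_
        ⟨0, by simp, Path.source _⟩ ⟨t, ht, rfl⟩ hdout)
      rintro _ ⟨t, ht, rfl⟩
      exact havoid h t ht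
    have h1 : (1 : unitInterval) ∈ closure {t : unitInterval | t ≠ 1} := by
      have : {t : unitInterval | t ≠ 1} = Set.Iio 1 := by
        ext t
        exact ⟨fun h => lt_of_le_of_ne unitInterval.le_one' h, fun h => ne_of_lt h⟩
      rw [this, closure_Iio' ⟨0, by simp⟩]
      simp
    have h2 := closure_minimal hsub (isClosed_closure.preimage (C.D.arc h).continuous) h1
    rw [mem_preimage, Path.target] at h2
    exact h2
  -- the precoloured path
  obtain ⟨ia, hia⟩ := enumEmb_surj S ((memS a).2 (by tauto))
  obtain ⟨ib, hib⟩ := enumEmb_surj S ((memS b).2 (by tauto))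
  obtain ⟨ic, hic⟩ := enumEmb_surj S ((memS c).2 (by tauto))
  have hia : f ia = a := hia
  have hib : f ib = b := hib
  have hic : f ic = c := hic
  have Hab : H.Adj ia ib := by
    refine ⟨by rw [hia, hib]; exact hab, ?_⟩
    rw [hia, hib]
    exact Or.inr (Or.inr (Or.inl rfl))
  have Hbc : H.Adj ib ic := by
    refine ⟨by rw [hib, hic]; exact hbc, ?_⟩
    rw [hib, hic]
    exact Or.inr (Or.inr (Or.inr rfl))
  let P' : H.Walk ia ic := .cons Hab (.cons Hbc .nil)
  have hsup : ∀ i, i ∈ P'.support ↔ (f i = a ∨ f i = b ∨ f i = c) := by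
    intro i
    have hi := f.injective
    simp only [P', SimpleGraph.Walk.support_cons, SimpleGraph.Walk.support_nil, List.mem_cons,
      List.not_mem_nil, or_false]
    rw [← hia, ← hib, ← hic, hi.eq_iff, hi.eq_iff, hi.eq_iff]
  have hnsup : ∀ i, i ∉ P'.support → C.D.pos (f i) ∈ enclosed K := by
    intro i hi
    rw [hsup] at hi
    exact ((memS _).1 (enumEmb_mem S i)).resolve_right hi
  have hsupK : ∀ i, i ∈ P'.support → C.D.pos (f i) ∈ K := by
    intro i hi
    rw [hsup] at hi
    rcases hi with h | h | h <;> rw [h] <;> assumption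
  let L' : Fin S.card → Finset ℕ := fun i =>
    if i ∈ P'.support then {φ (f i)}
    else if C.G.Adj d (f i) then (C.L (f i)).erase (φ d) else C.L (f i)
  have L1 : ∀ i, i ∈ P'.support → L' i = {φ (f i)} := fun i hi => by simp only [L', hi, if_true]
  have L5 : ∀ i, i ∉ P'.support → 5 ≤ (C.L (f i)).card := fun i hi =>
    C.size5 _ (enclosed_not_onOuter C.D hab hbc hcd hda C.plane (hnsup i hi))
  have L4 : ∀ i, i ∉ P'.support → 4 ≤ (L' i).card := by
    intro i hi
    have h5 := L5 i hi
    simp only [L', hi, if_false]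
    split_ifs
    · have := Finset.pred_card_le_card_erase (s := C.L (f i)) (a := φ d)
      omega
    · omega
  have Lsub : ∀ i, i ∉ P'.support → L' i ⊆ C.L (f i) := by
    intro i hi
    simp only [L', hi, if_false]
    split_ifs
    · exact Finset.erase_subset _ _
    · exact subset_rfl
  by_cases hcol : ListColorable H L'
  · obtain ⟨ψ, hψ1, hψ2⟩ := hcol
    have hψP : ∀ i, i ∈ P'.support → ψ i = φ (f i) := by
      intro i hi
      have := hψ1 i
      rw [L1 i hi] at this
      simpa using this
    let g : Fin C.n → ℕ := Function.extend f ψ 0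
    have hg : ∀ i, g (f i) = ψ i := fun i => f.injective.extend_apply _ _ _
    have encS : ∀ {v}, C.D.pos v ∈ enclosed K → ∃ i, f i = v ∧ i ∉ P'.support := by
      intro v hv
      obtain ⟨i, hi⟩ := enumEmb_surj S ((memS v).2 (Or.inl hv))
      have hi : f i = v := hi
      refine ⟨i, hi, fun h => ?_⟩
      exact nK (hsupK i h) (hi ▸ hv)
    have cross : ∀ {u v}, C.G.Adj u v → C.D.pos u ∈ enclosed K → C.D.pos v ∉ enclosed K →
        g u ≠ φ v := by
      intro u v huv hu hv
      obtain ⟨i, rfl, hi⟩ := encS hu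
      have hvK : C.D.pos v ∈ K :=
        (inner_arc C.D hab hbc hcd hda C.plane huv hu (C.D.right_mem_arcSet huv)).resolve_right hv
      by_cases hvd : v = d
      · subst hvd
        rw [hg]
        have h1 := hψ1 i
        simp only [L', hi, if_false, huv.symm, if_true] at h1
        exact (Finset.mem_erase.1 h1).1
      · have hvabc : v = a ∨ v = b ∨ v = c := by
          rcases fourSet_vertex C.D hab hbc hcd hda hvK with h | h | h | h
          · exact Or.inl h
          · exact Or.inr (Or.inl h)
          · exact Or.inr (Or.inr h)
          · exact absurd h hvd
        obtain ⟨j, hj⟩ := enumEmb_surj S ((memS v).2 (Or.inr hvabc))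
        have hj : f j = v := hj
        subst hj
        rw [hg, ← hψP j ((hsup j).2 hvabc)]
        exact hψ2 (show H.Adj i j from ⟨huv, Or.inl hu⟩)
    apply C.not_colorable
    refine ⟨fun v => if C.D.pos v ∈ enclosed K then g v else φ v, ?_, ?_⟩
    · intro v
      by_cases hv : C.D.pos v ∈ enclosed K
      · simp only [hv, if_true]
        obtain ⟨i, rfl, hi⟩ := encS hv
        rw [hg]
        exact Lsub i hi (hψ1 i)
      · simp only [hv, if_false]
        exact hφ1 v hv
    · intro u v huv
      by_cases hu : C.D.pos u ∈ enclosed K <;> by_cases hv : C.D.pos v ∈ enclosed K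
      · simp only [hu, hv, if_true]
        obtain ⟨i, rfl, -⟩ := encS hu
        obtain ⟨j, rfl, -⟩ := encS hv
        rw [hg, hg]
        exact hψ2 (show H.Adj i j from ⟨huv, Or.inl hu⟩)
      · simp only [hu, hv, if_true, if_false]
        exact cross huv hu hv
      · simp only [hu, hv, if_true, if_false]
        exact (cross huv.symm hv hu).symm
      · simp only [hu, hv, if_false]
        exact hφ2 u hu v hv huv
  · let C' : Config :=
      { n := S.card
        G := H
        D := D'
        plane := C.D.sub_plane f H hH C.plane
        a := ia
        b := ic
        P := P'
        P_path := by
          rw [SimpleGraph.Walk.isPath_def]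
          have h1 : ia ≠ ib := fun h => nab (by rw [← hia, ← hib, h])
          have h2 : ib ≠ ic := fun h => nbc (by rw [← hib, ← hic, h])
          have h3 : ia ≠ ic := fun h => hac (by rw [← hia, ← hic, h])
          simp [P', h1, h2, h3]
        P_len := by simp [P']
        P_boundary := by
          intro p hp
          refine mem_frontier_ext (hKcls ?_) (D'.walkSet_subset_graphSet _ hp)
          simp only [P', Drawing.walkSet_cons, Drawing.walkSet_nil] at hp
          rcases hp with hp | hp | hp
          · have hp : p ∈ C.D.arcSet (hH Hab) := hp
            rw [C.D.arcSet_congr (hH Hab) hab (by rw [hia, hib])] at hp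
            exact abK hp
          · have hp : p ∈ C.D.arcSet (hH Hbc) := hp
            rw [C.D.arcSet_congr (hH Hbc) hbc (by rw [hib, hic])] at hp
            exact bcK hp
          · have hp : p = C.D.pos (f ic) := hp
            rw [hp, hic]
            exact cK
        L := L'
        size5 := by
          intro i hi
          by_cases hP : i ∈ P'.support
          · exact absurd (mem_frontier_ext (hKcls (hsupK i hP)) (Or.inl ⟨i, rfl⟩)) hi
          · have : ¬ C.G.Adj d (f i) := fun h => hi (hnbr i h)
            simp only [L', hP, this, if_false]
            exact L5 i hP
        size3 := fun i _ hi => (by norm_num : 3 ≤ 4).trans (L4 i hi)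
        size1 := fun i hi => by rw [L1 i hi]; simp
        no_adjacent_3 := by
          intro i j _ hi
          by_cases hP : i ∈ P'.support
          · rw [L1 i hP] at hi
            simp at hi
          · have := L4 i hP
            omega
        proper_on_P := by
          intro i hi j hj hij
          rw [L1 i hi, L1 j hj]
          intro h
          exact hφ2 _ (nK (hsupK i hi)) _ (nK (hsupK j hj)) (hH hij)
            (Finset.singleton_injective h)
        common_neighbor := by
          intro p₀ p₁ p₂ hp y h0 h1 h2 heq
          by_cases hP : y ∈ P'.support
          · rw [hp] at hP
            simp only [List.mem_cons, List.not_mem_nil, or_false] at hP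
            rcases hP with rfl | rfl | rfl
            · exact H.irrefl h0
            · exact H.irrefl h1
            · exact H.irrefl h2
          · have h4 := L4 y hP
            rw [heq, L1 p₀ (by simp [hp]), L1 p₁ (by simp [hp]), L1 p₂ (by simp [hp])] at h4
            have e1 := Finset.card_union_le ({φ (f p₀)} ∪ {φ (f p₁)}) {φ (f p₂)}
            have e2 := Finset.card_union_le {φ (f p₀)} {φ (f p₁)}
            simp only [Finset.card_singleton] at e1 e2
            omega
        not_colorable := hcol }
    have h1 := hmin.1 C'
    have h2 := sub_size_lt C.G S d hdS f H hH
    exact absurd h1 (not_le.2 h2)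

/-- In a minimal counterexample configuration for the precolored-path 5-choosability
theorem, there is no separating 4-cycle: no vertex of the graph is drawn in the open
disc bounded by (the drawing of) a cycle of length four. -/
theorem minimal_counterexample_no_separating_4_cycle
    (C : Config) (hmin : C.Minimal)
    {r : Fin C.n} (K : C.G.Walk r r) (hKcyc : K.IsCycle) (hKlen : K.length = 4) :
    ∀ x : Fin C.n, C.D.pos x ∉ enclosed (C.D.walkSet K) := by
  intro x
  match K, hKcyc, hKlen with
  | .cons (v := k1) h1 (.cons (v := k2) h2 (.cons (v := k3) h3 (.cons h4 .nil))), hc, _ =>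
    have hnd := hc.support_nodup
    simp only [SimpleGraph.Walk.support_cons, SimpleGraph.Walk.support_nil, List.tail_cons,
      List.nodup_cons, List.mem_cons, List.not_mem_nil, or_false, not_or] at hnd
    have hset : C.D.walkSet (.cons h1 (.cons h2 (.cons h3 (.cons h4 .nil)))) =
        fourSet C.D h1 h2 h3 h4 := by
      simp only [Drawing.walkSet_cons, Drawing.walkSet_nil, fourSet]
      have := C.D.right_mem_arcSet h4
      ext p
      simp only [mem_union, mem_singleton_iff]
      constructor
      · rintro (h | h | h | h | rfl) <;> tauto
      · tauto
    rw [hset]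
    exact four_main C hmin h1 h2 h3 h4 (fun h => hnd.2.1.2 h.symm) hnd.1.2.1 x
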